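/- arXiv:2501.08950 — 7 statements merged into one kernel-verified Lean document; each statement's English description precedes it below -/
import Mathlib

section
/- Let d ∈ ℕ, let X ⊆ ℝ^d be a closed set of vectors with non-negative entries containing 0, and let f : X → X be a monotone function that has at least one fixpoint. Then f has a least fixpoint μf with respect to the componentwise order. Moreover, if f is additionally continuous, then μf equals the supremum of the Kleene iterates: μf = ⊔_{n∈ℕ} f^n(0). -/
open Filter Set Topology

/-- The coordinatewise supremum of a nonempty bounded family in `ℝ^d` is its least upper bound. -/
lemma isLUB_range_pi_iSup {ι κ : Type*} [Nonempty ι] {u : ι → κ → ℝ} {b : κ → ℝ}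
    (hb : ∀ n, u n ≤ b) : IsLUB (range u) fun i => ⨆ n, u n i := by
  have hbdd (i : κ) : BddAbove (range fun n => u n i) :=
    ⟨b i, by rintro _ ⟨n, rfl⟩; exact hb n i⟩
  constructor
  · rintro _ ⟨n, rfl⟩ i
    exact le_ciSup (hbdd i) n
  · intro c hc i
    exact ciSup_le fun n => hc ⟨n, rfl⟩ i

/-- Existence of least fixpoints for monotone functions on closed
subsets of the non-negative orthant of `ℝ^d` containing `0`, together with the
Kleene characterisation for continuous functions. -/
theorem least_fixpoint_exists
    (d : ℕ) (X : Set (Fin d → ℝ)) (hX : IsClosed X)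
    (hpos : ∀ x ∈ X, ∀ i, 0 ≤ x i) (h0 : (0 : Fin d → ℝ) ∈ X)
    (f : (Fin d → ℝ) → (Fin d → ℝ)) (hmap : Set.MapsTo f X X)
    (hmono : ∀ x ∈ X, ∀ y ∈ X, x ≤ y → f x ≤ f y)
    (hfix : ∃ x ∈ X, f x = x) :
    ∃ μ : Fin d → ℝ, IsLeast {x | x ∈ X ∧ f x = x} μ ∧
      (ContinuousOn f X → μ = fun i => ⨆ n : ℕ, f^[n] 0 i) := by
  obtain ⟨p, hpX, hp⟩ := hfix
  let A : Set (Fin d → ℝ) := {x | x ∈ X ∧ x ≤ f x ∧ ∀ q ∈ X, f q = q → x ≤ q}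
  have hA0 : (0 : Fin d → ℝ) ∈ A := ⟨h0, hpos _ (hmap h0), fun q hq _ => hpos q hq⟩
  have hAf : ∀ x ∈ A, f x ∈ A := fun x ⟨hx, hxf, hxq⟩ =>
    ⟨hmap hx, hmono x hx _ (hmap hx) hxf,
      fun q hq hqf => hqf ▸ hmono x hx q hq (hxq q hq hqf)⟩
  have hchain : ∀ C ⊆ A, IsChain (· ≤ ·) C → C.Nonempty → ∃ ub ∈ A, ∀ z ∈ C, z ≤ ub := by
    intro C hCA hC hne
    have : Nonempty C := hne.to_subtype
    have : IsDirectedOrder C := ⟨fun a b => by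
      rcases hC.total a.2 b.2 with h | h
      · exact ⟨b, h, le_rfl⟩
      · exact ⟨a, le_rfl, h⟩⟩
    have hlub := isLUB_range_pi_iSup (u := fun c : C => (c : Fin d → ℝ))
      fun c => (hCA c.2).2.2 p hpX hp
    have hsX := hX.mem_of_tendsto (tendsto_atTop_isLUB (Subtype.mono_coe (· ∈ C)) hlub)
      (Eventually.of_forall fun c => (hCA c.2).1)
    have hle : ∀ z ∈ C, z ≤ _ := fun z hz => hlub.1 ⟨⟨z, hz⟩, rfl⟩
    refine ⟨_, ⟨hsX, hlub.2 ?_, fun q hq hqf => hlub.2 ?_⟩, hle⟩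
    · rintro _ ⟨c, rfl⟩
      exact (hCA c.2).2.1.trans (hmono _ (hCA c.2).1 _ hsX (hle c c.2))
    · rintro _ ⟨c, rfl⟩
      exact (hCA c.2).2.2 q hq hqf
  obtain ⟨m, -, hm⟩ := zorn_le_nonempty₀ A
    (fun C hCA hC y hy => hchain C hCA hC ⟨y, hy⟩) 0 hA0
  have hmA : m ∈ A := hm.prop
  have hmf : f m = m := (hm.eq_of_le (hAf m hmA) hmA.2.1).symm
  refine ⟨m, ⟨⟨hmA.1, hmf⟩, fun q hq => hmA.2.2 q hq.1 hq.2⟩, fun hcont => ?_⟩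
  have hiter : ∀ n, f^[n] 0 ∈ A := by
    intro n
    induction n with
    | zero => exact hA0
    | succ n ih => rw [Function.iterate_succ_apply']; exact hAf _ ih
  have hmon : Monotone fun n => f^[n] 0 := monotone_nat_of_le_succ fun n => by
    rw [Function.iterate_succ_apply']; exact (hiter n).2.1
  have hlub := isLUB_range_pi_iSup (u := fun n => f^[n] 0)
    fun n => (hiter n).2.2 m hmA.1 hmf
  have ht := tendsto_atTop_isLUB hmon hlub
  have hsX := hX.mem_of_tendsto ht (Eventually.of_forall fun n => (hiter n).1)
  have ht' := (hcont _ hsX).tendsto.comp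
    (tendsto_nhdsWithin_iff.2 ⟨ht, Eventually.of_forall fun n => (hiter n).1⟩)
  have hshift := (tendsto_add_atTop_iff_nat 1).2 ht
  have hfs := tendsto_nhds_unique ht' (by
    simpa only [Function.comp_def, Function.iterate_succ_apply'] using hshift)
  refine le_antisymm (hmA.2.2 _ hsX hfs) (hlub.2 ?_)
  rintro _ ⟨n, rfl⟩
  exact (hiter n).2.2 m hmA.1 hmf
end

section
/- Let f : X → X be monotone and non-expansive with at least one fixpoint, let (α_n), (β_n) be sequences in [0,1), let x_0 ∈ X, and let (x_n) be the dampened Mann iteration with the constant function sequence f_n = f. Then for every fixpoint x̄ of f and every n ∈ ℕ one has ‖x_n − x̄‖ ≤ max(‖x̄‖, ‖x_0 − x̄‖); in particular the sequence (x_n) is bounded. -/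
open Filter Set Topology

/-- The dampened Mann iteration:
`x₀ = x0`, `x_{n+1} = (1 - β n) • (α n • x n + (1 - α n) • f n (x n))`. -/
noncomputable def mannSeq {E : Type*} [AddCommGroup E] [Module ℝ E]
    (α β : ℕ → ℝ) (f : ℕ → E → E) (x0 : E) : ℕ → E
  | 0 => x0
  | n + 1 => (1 - β n) • (α n • mannSeq α β f x0 n + (1 - α n) • f n (mannSeq α β f x0 n))

/-- A convex set containing `0` and invariant under every `f n` is invariant under the
dampened Mann iteration. -/
theorem mannSeq_mem {E : Type*} [AddCommGroup E] [Module ℝ E] {S : Set E}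
    (hS : Convex ℝ S) (h0 : (0 : E) ∈ S) {α β : ℕ → ℝ} {f : ℕ → E → E}
    (hf : ∀ n, MapsTo (f n) S S) (hα : ∀ n, α n ∈ Ico (0 : ℝ) 1)
    (hβ : ∀ n, β n ∈ Ico (0 : ℝ) 1) {x0 : E} (hx0 : x0 ∈ S) (n : ℕ) :
    mannSeq α β f x0 n ∈ S := by
  induction n with
  | zero => exact hx0
  | succ n ih =>
    exact hS.smul_mem_of_zero_mem h0
      (hS ih (hf n ih) (hα n).1 (sub_nonneg.2 (hα n).2.le) (add_sub_cancel _ _))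
      ⟨sub_nonneg.2 (hβ n).2.le, sub_le_self _ (hβ n).1⟩

/-- the dampened Mann iteration (with the constant function
sequence) stays within distance `max ‖x̄‖ ‖x₀ - x̄‖` of every fixpoint `x̄`;
in particular it is bounded. -/
theorem mann_iteration_bounded
    (d : ℕ) (X : Set (Fin d → ℝ)) (hX : IsClosed X) (hXc : Convex ℝ X)
    (hpos : ∀ x ∈ X, ∀ i, 0 ≤ x i) (h0 : (0 : Fin d → ℝ) ∈ X)
    (f : (Fin d → ℝ) → (Fin d → ℝ)) (hmap : Set.MapsTo f X X)
    (hmono : ∀ x ∈ X, ∀ y ∈ X, x ≤ y → f x ≤ f y)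
    (hne : LipschitzOnWith 1 f X)
    (hfix : ∃ x ∈ X, f x = x)
    (α β : ℕ → ℝ) (hα : ∀ n, α n ∈ Set.Ico (0 : ℝ) 1) (hβ : ∀ n, β n ∈ Set.Ico (0 : ℝ) 1)
    (x0 : Fin d → ℝ) (hx0 : x0 ∈ X) :
    ∀ xbar ∈ X, f xbar = xbar →
      ∀ n, ‖mannSeq α β (fun _ => f) x0 n - xbar‖ ≤ max ‖xbar‖ ‖x0 - xbar‖ := by
  intro xbar hxbar hfx n
  have hmem : mannSeq α β (fun _ => f) x0 n ∈
      X ∩ Metric.closedBall xbar (max ‖xbar‖ ‖x0 - xbar‖) := by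
    refine mannSeq_mem (hXc.inter (convex_closedBall _ _)) ⟨h0, ?_⟩ (fun _ y hy => ?_)
      hα hβ ⟨hx0, ?_⟩ n
    · simp
    · refine ⟨hmap hy.1, ?_⟩
      have h := hne.dist_le_mul y hy.1 xbar hxbar
      rw [hfx, NNReal.coe_one, one_mul] at h
      exact h.trans hy.2
    · simp [dist_eq_norm]
  exact mem_closedBall_iff_norm.1 hmem.2
end

section
/- Assume (f_n) is a sequence of monotone non-expansive functions f_n : X → X converging pointwise to a function f : X → X which has at least one fixpoint. Let ((α_n),(β_n)) be a relaxed Mann-Kleene scheme, let x_0 ∈ X, and let (x_n) be the dampened Mann iteration with function sequence (f_n). If the sequence (x_n) is bounded, then for every coordinate i ∈ {1,…,d} one has liminf_{n→∞} (x_n)_i ≥ (μf)_i. -/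
open Filter Set Topology

/-- Pointwise convergence of non-expansive maps allows convergent arguments. -/
lemma tendsto_apply_of_lipschitzOnWith_one {E : Type*} [PseudoMetricSpace E] {X : Set E}
    {F : ℕ → E → E} (hF : ∀ n, LipschitzOnWith 1 (F n) X) {y : ℕ → E} {z w : E}
    (hy : ∀ n, y n ∈ X) (hz : z ∈ X) (hyz : Tendsto y atTop (𝓝 z))
    (hw : Tendsto (fun n => F n z) atTop (𝓝 w)) :
    Tendsto (fun n => F n (y n)) atTop (𝓝 w) := by
  refine tendsto_of_tendsto_of_dist hw ?_
  refine squeeze_zero (fun _ => dist_nonneg) (fun n => ?_) (tendsto_iff_dist_tendsto_zero.1 hyz)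
  simpa [dist_comm] using (hF n).dist_le_mul z hz (y n) (hy n)

/-- One step of the dampened Mann iteration. -/
def mannStep {E : Type*} [AddCommGroup E] [Module ℝ E] (a b : ℝ) (f : E → E) (x : E) : E :=
  (1 - b) • (a • x + (1 - a) • f x)

lemma mannStep_mem {E : Type*} [AddCommGroup E] [Module ℝ E] {X : Set E} (hXc : Convex ℝ X)
    (h0 : (0 : E) ∈ X) {a b : ℝ} (ha : a ∈ Set.Icc (0 : ℝ) 1) (hb : b ∈ Set.Icc (0 : ℝ) 1)
    {f : E → E} (hf : Set.MapsTo f X X) {x : E} (hx : x ∈ X) : mannStep a b f x ∈ X :=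
  hXc.smul_mem_of_zero_mem h0
    (hXc hx (hf hx) ha.1 (sub_nonneg.2 ha.2) (add_sub_cancel a 1))
    ⟨sub_nonneg.2 hb.2, sub_le_self 1 hb.1⟩

lemma mannStep_mono {d : ℕ} {a b : ℝ} (ha : a ∈ Set.Icc (0 : ℝ) 1) (hb : b ≤ 1)
    {f : (Fin d → ℝ) → (Fin d → ℝ)} {x y : Fin d → ℝ} (hxy : x ≤ y) (hf : f x ≤ f y) :
    mannStep a b f x ≤ mannStep a b f y :=
  smul_le_smul_of_nonneg_left
    (add_le_add (smul_le_smul_of_nonneg_left hxy ha.1)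
      (smul_le_smul_of_nonneg_left hf (sub_nonneg.2 ha.2))) (sub_nonneg.2 hb)

/-- The limit of a pointwise convergent sequence of non-expansive maps is non-expansive. -/
lemma lipschitzOnWith_one_of_tendsto {E : Type*} [PseudoMetricSpace E] {X : Set E}
    {F : ℕ → E → E} {f : E → E} (hF : ∀ n, LipschitzOnWith 1 (F n) X)
    (hconv : ∀ x ∈ X, Tendsto (fun n => F n x) atTop (𝓝 (f x))) : LipschitzOnWith 1 f X :=
  LipschitzOnWith.of_dist_le_mul fun x hx y hy =>
    le_of_tendsto ((hconv x hx).dist (hconv y hy))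
      (Eventually.of_forall fun n => (hF n).dist_le_mul x hx y hy)

/-- The undampened relaxed Kleene iteration of a monotone non-expansive map from `0` converges to
its least fixpoint. -/
lemma tendsto_iterate_mannStep_lfp {d : ℕ} {X : Set (Fin d → ℝ)} (hX : IsClosed X)
    (hXc : Convex ℝ X) (hpos : ∀ x ∈ X, 0 ≤ x) (h0 : (0 : Fin d → ℝ) ∈ X)
    {a : ℝ} (ha0 : 0 ≤ a) (ha1 : a < 1) {f : (Fin d → ℝ) → (Fin d → ℝ)}
    (hmap : Set.MapsTo f X X) (hmono : MonotoneOn f X) (hlip : LipschitzOnWith 1 f X)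
    {μ : Fin d → ℝ} (hμ : IsLeast {x | x ∈ X ∧ f x = x} μ) :
    Tendsto (fun n => (mannStep a 0 f)^[n] 0) atTop (𝓝 μ) := by
  obtain ⟨⟨hμX, hμf⟩, hμle⟩ := hμ
  have haI : a ∈ Set.Icc (0 : ℝ) 1 := ⟨ha0, ha1.le⟩
  have hfixed : mannStep a 0 f μ = μ := by
    simp [mannStep, hμf, ← add_smul]
  set z : ℕ → Fin d → ℝ := fun n => (mannStep a 0 f)^[n] 0 with hz
  have hzs : ∀ n, z (n + 1) = mannStep a 0 f (z n) := fun n =>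
    Function.iterate_succ_apply' _ _ _
  have hzX : ∀ n, z n ∈ X := fun n => by
    induction n with
    | zero => exact h0
    | succ n ih => exact hzs n ▸ mannStep_mem hXc h0 haI (by simp) hmap ih
  have hstep : ∀ x ∈ X, ∀ y ∈ X, x ≤ y → mannStep a 0 f x ≤ mannStep a 0 f y :=
    fun x hx y hy hxy => mannStep_mono haI zero_le_one hxy (hmono hx hy hxy)
  have hzmono : Monotone z := monotone_nat_of_le_succ fun n => by
    induction n with
    | zero => exact hpos _ (hzX 1)
    | succ n ih =>
      rw [hzs n, hzs (n + 1)]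
      exact hstep _ (hzX n) _ (hzX (n + 1)) ih
  have hzμ : ∀ n, z n ≤ μ := fun n => by
    induction n with
    | zero => exact hpos _ hμX
    | succ n ih =>
      rw [hzs n, ← hfixed]
      exact hstep _ (hzX n) _ hμX ih
  have hlim := tendsto_atTop_ciSup hzmono ⟨μ, Set.forall_mem_range.2 hzμ⟩
  set L := ⨆ n, z n
  have hLX : L ∈ X := hX.mem_of_tendsto hlim (Eventually.of_forall hzX)
  have hLμ : L ≤ μ := le_of_tendsto' hlim hzμ
  have hfz : Tendsto (fun n => f (z n)) atTop (𝓝 (f L)) :=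
    tendsto_apply_of_lipschitzOnWith_one (fun _ => hlip) hzX hLX hlim tendsto_const_nhds
  have hL : L = a • L + (1 - a) • f L := by
    refine tendsto_nhds_unique ((tendsto_add_atTop_iff_nat 1).2 hlim) ?_
    simpa only [hzs, mannStep, sub_zero, one_smul] using
      (hlim.const_smul a).add (hfz.const_smul (1 - a))
  have hfL : f L = L := by
    refine smul_right_injective _ (sub_pos.2 ha1).ne' ?_
    change (1 - a) • f L = (1 - a) • L
    rw [sub_smul 1 a L, one_smul]
    exact eq_sub_of_add_eq' hL.symm
  exact (hLμ.antisymm (hμle ⟨hLX, hfL⟩)) ▸ hlim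

/-- for a relaxed Mann-Kleene scheme and a sequence of monotone
non-expansive functions `fn` converging pointwise to `f` (which has a
fixpoint), if the dampened Mann iteration is bounded then componentwise
`liminf xₙ ≥ μf`. -/
theorem liminf_ge_lfp
    (α β : ℕ → ℝ) (hα : ∀ n, α n ∈ Set.Ico (0 : ℝ) 1) (hβ : ∀ n, β n ∈ Set.Ico (0 : ℝ) 1)
    (hβ0 : Tendsto β atTop (nhds 0)) (hβdiv : ¬ Summable β)
    (a : ℝ) (ha : a < 1) (hαa : Tendsto α atTop (nhds a))
    (d : ℕ) (X : Set (Fin d → ℝ)) (hX : IsClosed X) (hXc : Convex ℝ X)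
    (hpos : ∀ x ∈ X, ∀ i, 0 ≤ x i) (h0 : (0 : Fin d → ℝ) ∈ X)
    (fn : ℕ → (Fin d → ℝ) → (Fin d → ℝ))
    (hfnmap : ∀ n, Set.MapsTo (fn n) X X)
    (hfnmono : ∀ n, ∀ x ∈ X, ∀ y ∈ X, x ≤ y → fn n x ≤ fn n y)
    (hfnne : ∀ n, LipschitzOnWith 1 (fn n) X)
    (f : (Fin d → ℝ) → (Fin d → ℝ)) (hmap : Set.MapsTo f X X)
    (hconv : ∀ x ∈ X, Tendsto (fun n => fn n x) atTop (nhds (f x)))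
    (hfix : ∃ x ∈ X, f x = x)
    (μ : Fin d → ℝ) (hμ : IsLeast {x | x ∈ X ∧ f x = x} μ)
    (x0 : Fin d → ℝ) (hx0 : x0 ∈ X)
    (hbdd : ∃ C, ∀ n, ‖mannSeq α β fn x0 n‖ ≤ C) :
    ∀ i, μ i ≤ Filter.liminf (fun n => mannSeq α β fn x0 n i) atTop := by
  have hα' : ∀ n, α n ∈ Set.Icc (0 : ℝ) 1 := fun n => Set.Ico_subset_Icc_self (hα n)
  have hβ' : ∀ n, β n ∈ Set.Icc (0 : ℝ) 1 := fun n => Set.Ico_subset_Icc_self (hβ n)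
  have ha0 : 0 ≤ a := ge_of_tendsto' hαa fun n => (hα n).1
  have hlip : LipschitzOnWith 1 f X := lipschitzOnWith_one_of_tendsto hfnne hconv
  have hmono : MonotoneOn f X := fun x hx y hy hxy =>
    le_of_tendsto_of_tendsto' (hconv x hx) (hconv y hy) fun n => hfnmono n x hx y hy hxy
  set x := mannSeq α β fn x0
  have hxs : ∀ n, x (n + 1) = mannStep (α n) (β n) (fn n) (x n) := fun _ => rfl
  have hxX : ∀ n, x n ∈ X := fun n => by
    induction n with
    | zero => exact hx0
    | succ n ih => exact hxs n ▸ mannStep_mem hXc h0 (hα' n) (hβ' n) (hfnmap n) ih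
  have hzX : ∀ k, (mannStep a 0 f)^[k] 0 ∈ X := fun k => by
    induction k with
    | zero => exact h0
    | succ k ih =>
      rw [Function.iterate_succ_apply']
      exact mannStep_mem hXc h0 ⟨ha0, ha.le⟩ (by simp) hmap ih
  -- Each relaxed Kleene iterate is a limit of lower bounds: restart the iteration `k` steps ago.
  have hbelow : ∀ k, ∃ y : ℕ → Fin d → ℝ, (∀ n, y n ∈ X) ∧ (∀ n, y n ≤ x n) ∧
      Tendsto y atTop (𝓝 ((mannStep a 0 f)^[k] 0)) := fun k => by
    induction k with
    | zero => exact ⟨fun _ => 0, fun _ => h0, fun n => hpos _ (hxX n), tendsto_const_nhds⟩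
    | succ k ih =>
      obtain ⟨y, hyX, hyx, hy⟩ := ih
      refine ⟨fun n => n.casesOn 0 fun m => mannStep (α m) (β m) (fn m) (y m), ?_, ?_, ?_⟩
      · rintro (_ | n)
        · exact h0
        · exact mannStep_mem hXc h0 (hα' n) (hβ' n) (hfnmap n) (hyX n)
      · rintro (_ | n)
        · exact hpos _ hx0
        · exact mannStep_mono (hα' n) (hβ' n).2 (hyx n)
            (hfnmono n _ (hyX n) _ (hxX n) (hyx n))
      · rw [← tendsto_add_atTop_iff_nat 1, Function.iterate_succ_apply']
        exact (tendsto_const_nhds.sub hβ0).smul ((hαa.smul hy).add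
          ((tendsto_const_nhds.sub hαa).smul
            (tendsto_apply_of_lipschitzOnWith_one hfnne hyX (hzX k) hy (hconv _ (hzX k)))))
  obtain ⟨C, hC⟩ := hbdd
  intro i
  have hlim := tendsto_iterate_mannStep_lfp hX hXc hpos h0 ha0 ha hmap hmono hlip hμ
  refine le_of_tendsto' (tendsto_pi_nhds.1 hlim i) fun k => ?_
  obtain ⟨y, -, hyx, hy⟩ := hbelow k
  have hyi := tendsto_pi_nhds.1 hy i
  rw [← hyi.liminf_eq]
  refine liminf_le_liminf (Eventually.of_forall fun n => hyx n i) hyi.isBoundedUnder_ge ?_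
  exact (isBoundedUnder_of ⟨C, fun n =>
    (le_abs_self _).trans ((norm_le_pi_norm (x n) i).trans (hC n))⟩ :
    IsBoundedUnder (· ≤ ·) atTop fun n => x n i).isCoboundedUnder_ge
end

section
/- Let S be a finite set, let h : ℝ≥0^S → ℝ≥0^S be witness-bounded with witness u : ℝ≥0^S → ℝ≥0^S, and let k ∈ ℕ and 0 ≤ c < 1 be such that ‖u^k(v)‖ ≤ c·‖v‖ for all v ∈ ℝ≥0^S. Then the k-fold iterate h^k is a contraction with Lipschitz constant c for the supremum norm: ‖h^k(v) − h^k(v')‖ ≤ c·‖v − v'‖ for all v, v' ∈ ℝ≥0^S. -/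
open Filter Set Topology

/-- If `h` moves points of the non-negative orthant apart by at most `u` of their distance vector,
and `u` is monotone there, then `h^[n]` moves them apart by at most `u^[n]` of it. -/
theorem abs_iterate_sub_iterate_le {S : Type*} {h u : (S → ℝ) → (S → ℝ)}
    (hmaph : MapsTo h {v | ∀ s, 0 ≤ v s} {v | ∀ s, 0 ≤ v s})
    (hmapu : MapsTo u {v | ∀ s, 0 ≤ v s} {v | ∀ s, 0 ≤ v s})
    (humono : MonotoneOn u {v | ∀ s, 0 ≤ v s})
    (hhb : ∀ v ∈ {v : S → ℝ | ∀ s, 0 ≤ v s}, ∀ w ∈ {v : S → ℝ | ∀ s, 0 ≤ v s},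
      ∀ s, |h v s - h w s| ≤ u (fun t => |v t - w t|) s)
    {v w : S → ℝ} (hv : ∀ s, 0 ≤ v s) (hw : ∀ s, 0 ≤ w s) (n : ℕ) (s : S) :
    |h^[n] v s - h^[n] w s| ≤ u^[n] (fun t => |v t - w t|) s := by
  induction n generalizing s with
  | zero => exact le_rfl
  | succ n ih =>
    simp only [Function.iterate_succ_apply']
    refine (hhb _ (hmaph.iterate n hv) _ (hmaph.iterate n hw) s).trans ?_
    exact humono (fun t => abs_nonneg _) (hmapu.iterate n fun t => abs_nonneg _) ih s

/-- if `h` is witness-bounded with witness `u`, and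
`‖u^[k] v‖ ≤ c ‖v‖` on the non-negative orthant with `0 ≤ c < 1`, then `h^[k]`
is a contraction with constant `c` for the supremum norm. -/
theorem witness_bounded_power_contraction
    (S : Type) [Fintype S]
    (h u : (S → ℝ) → (S → ℝ))
    (hmaph : Set.MapsTo h {v : S → ℝ | ∀ s, 0 ≤ v s} {v : S → ℝ | ∀ s, 0 ≤ v s})
    (hmapu : Set.MapsTo u {v : S → ℝ | ∀ s, 0 ≤ v s} {v : S → ℝ | ∀ s, 0 ≤ v s})
    (humono : ∀ v ∈ {v : S → ℝ | ∀ s, 0 ≤ v s}, ∀ w ∈ {v : S → ℝ | ∀ s, 0 ≤ v s},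
      v ≤ w → u v ≤ u w)
    (huwit : ∀ v ∈ {v : S → ℝ | ∀ s, 0 ≤ v s}, ∀ w ∈ {v : S → ℝ | ∀ s, 0 ≤ v s},
      ∀ s, |u v s - u w s| ≤ u (fun t => |v t - w t|) s)
    (k : ℕ) (c : ℝ) (hc0 : 0 ≤ c) (hc1 : c < 1)
    (hpow : ∀ v ∈ {v : S → ℝ | ∀ s, 0 ≤ v s}, ‖u^[k] v‖ ≤ c * ‖v‖)
    (hhb : ∀ v ∈ {v : S → ℝ | ∀ s, 0 ≤ v s}, ∀ w ∈ {v : S → ℝ | ∀ s, 0 ≤ v s},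
      ∀ s, |h v s - h w s| ≤ u (fun t => |v t - w t|) s) :
    ∀ v ∈ {v : S → ℝ | ∀ s, 0 ≤ v s}, ∀ w ∈ {v : S → ℝ | ∀ s, 0 ≤ v s},
      ‖h^[k] v - h^[k] w‖ ≤ c * ‖v - w‖ := by
  intro v hv w hw
  have habs : ‖fun t => |v t - w t|‖ ≤ ‖v - w‖ :=
    (pi_norm_le_iff_of_nonneg (norm_nonneg _)).2 fun t => by
      simpa using norm_le_pi_norm (v - w) t
  have hiter : ‖h^[k] v - h^[k] w‖ ≤ ‖u^[k] fun t => |v t - w t|‖ :=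
    (pi_norm_le_iff_of_nonneg (norm_nonneg _)).2 fun s =>
      (abs_iterate_sub_iterate_le hmaph hmapu (fun a ha b hb => humono a ha b hb) hhb hv hw k s).trans
        ((le_abs_self _).trans (norm_le_pi_norm (u^[k] fun t => |v t - w t|) s))
  calc ‖h^[k] v - h^[k] w‖ ≤ ‖u^[k] fun t => |v t - w t|‖ := hiter
    _ ≤ c * ‖fun t => |v t - w t|‖ := hpow _ fun t => abs_nonneg _
    _ ≤ c * ‖v - w‖ := mul_le_mul_of_nonneg_left habs hc0
end

section
/- Let M = (S, A, T, R) be a simple MDP, i.e. an MDP with no end-components. Then there is a function rank : S → ℕ such that for all s ∈ S: rank(s) < |S|; rank(s) = 0 implies s is final (A(s) = ∅); and for every a ∈ A(s) there exists s' ∈ S with T(s,a,s') > 0 and rank(s') < rank(s). -/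
open Filter Set Topology

/-- A Markov decision process with state space `S` and action space `A`:
transition probabilities `T s a s' ∈ [0,1]` with `Σ_{s'} T s a s' ∈ {0,1}` and
non-negative rewards `R`. -/
structure MDP (S A : Type) [Fintype S] [Fintype A] where
  T : S → A → S → ℝ
  R : S → A → S → ℝ
  T_nonneg : ∀ s a s', 0 ≤ T s a s'
  T_le_one : ∀ s a s', T s a s' ≤ 1
  T_sum : ∀ s a, (∑ s', T s a s') = 0 ∨ (∑ s', T s a s') = 1
  R_nonneg : ∀ s a s', 0 ≤ R s a s'

variable {S A : Type} [Fintype S] [Fintype A]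

/-- Action `a` is enabled in state `s`. -/
def MDP.enabled (M : MDP S A) (s : S) (a : A) : Prop :=
  (∑ s', M.T s a s') = 1

/-- The state-value Bellman operator
`f_M(v)(s) = max_{a ∈ A(s)} Σ_{s'} T(s,a,s') (R(s,a,s') + v(s'))`,
with the maximum over the empty set taken to be `0`. -/
noncomputable def MDP.bellman (M : MDP S A) (v : S → ℝ) : S → ℝ :=
  fun s => sSup (insert 0
    {x : ℝ | ∃ a, M.enabled s a ∧ x = ∑ s', M.T s a s' * (M.R s a s' + v s')})

/-- One step inside a candidate end-component: from `t` (in `S'`) one can move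
to `t'` with positive probability using an action from `A' t`. -/
def MDP.ecStep (M : MDP S A) (S' : Set S) (A' : S → Set A) (t t' : S) : Prop :=
  t ∈ S' ∧ ∃ a ∈ A' t, 0 < M.T t a t'

/-- `(S', A')` is an end-component of `M`. -/
def MDP.IsEndComponent (M : MDP S A) (S' : Set S) (A' : S → Set A) : Prop :=
  S'.Nonempty ∧
  (∀ s ∈ S', (A' s).Nonempty ∧ ∀ a ∈ A' s, M.enabled s a) ∧
  (∀ s ∉ S', A' s = ∅) ∧
  (∀ s ∈ S', ∀ a ∈ A' s, ∀ s', 0 < M.T s a s' → s' ∈ S') ∧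
  (∀ s ∈ S', ∀ s' ∈ S', Relation.ReflTransGen (M.ecStep S' A') s s')

/-- `(S', A')` is a maximal end-component of `M` (no strictly larger
end-component under pointwise inclusion exists). -/
def MDP.IsMaximalEC (M : MDP S A) (S' : Set S) (A' : S → Set A) : Prop :=
  M.IsEndComponent S' A' ∧
  ∀ S'' A'', M.IsEndComponent S'' A'' → S' ⊆ S'' → (∀ s, A' s ⊆ A'' s) →
    S'' = S' ∧ ∀ s, A'' s = A' s

/-- A nonempty set of states, each of which has an enabled action that cannot leave the set,
gives rise to an end-component. -/
theorem MDP.exists_isEndComponent_of_closed (M : MDP S A) (C : Set S) (hne : C.Nonempty)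
    (hC : ∀ s ∈ C, ∃ a, M.enabled s a ∧ ∀ s', 0 < M.T s a s' → s' ∈ C) :
    ∃ S' A', M.IsEndComponent S' A' := by
  let P : Set S → Prop := fun D =>
    D.Nonempty ∧ ∀ s ∈ D, ∃ a, M.enabled s a ∧ ∀ s', 0 < M.T s a s' → s' ∈ D
  obtain ⟨D, hD⟩ := (Set.toFinite {D | P D}).exists_minimal ⟨C, hne, hC⟩
  obtain ⟨⟨hDne, hDcl⟩, hmin⟩ := hD
  have : Nonempty A := hDne.elim fun s hs => (hDcl s hs).nonempty
  choose! π hen hcl using hDcl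
  let A' : S → Set A := fun t => {a | t ∈ D ∧ a = π t}
  refine ⟨D, A', hDne, fun s hs => ⟨⟨π s, hs, rfl⟩, ?_⟩, ?_, ?_, ?_⟩
  · rintro a ⟨-, rfl⟩
    exact hen s hs
  · intro s hs
    ext a
    simp [A', hs]
  · rintro s hs a ⟨-, rfl⟩
    exact hcl s hs
  · intro s hs t ht
    let E : Set S := {t | t ∈ D ∧ Relation.ReflTransGen (M.ecStep D A') s t}
    have hE : P E := by
      refine ⟨⟨s, hs, .refl⟩, fun u hu => ⟨π u, hen u hu.1, fun s' h => ?_⟩⟩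
      exact ⟨hcl u hu.1 s' h, hu.2.tail ⟨hu.1, π u, ⟨hu.1, rfl⟩, h⟩⟩
    exact (hmin hE (fun u hu => hu.1) ht).2

/-- In an MDP without end-components, any number `n ≤ |S|` of states can be ranked below `n` so
that every enabled action may decrease the rank. -/
theorem MDP.exists_partial_ranking (M : MDP S A)
    (hsimple : ∀ S' A', ¬ M.IsEndComponent S' A') (n : ℕ) (hn : n ≤ Fintype.card S) :
    ∃ (D : Finset S) (rank : S → ℕ), D.card = n ∧ ∀ s ∈ D, rank s < n ∧
      ∀ a, M.enabled s a → ∃ s' ∈ D, 0 < M.T s a s' ∧ rank s' < rank s := by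
  classical
  induction n with
  | zero => exact ⟨∅, fun _ => 0, by simp⟩
  | succ n ih =>
    obtain ⟨D, rank, hcard, hD⟩ := ih (by omega)
    obtain ⟨s, hs, hexit⟩ : ∃ s, s ∉ D ∧ ∀ a, M.enabled s a → ∃ s' ∈ D, 0 < M.T s a s' := by
      by_contra! h
      have hne : ∃ s, s ∉ D := by
        by_contra! hall
        have := Finset.card_eq_iff_eq_univ D |>.2 (Finset.eq_univ_of_forall hall)
        omega
      obtain ⟨S', A', hEC⟩ := M.exists_isEndComponent_of_closed {s | s ∉ D} hne fun s hs => by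
        obtain ⟨a, ha, hstay⟩ := h s hs
        exact ⟨a, ha, fun s' hpos hmem => absurd hpos (not_lt.2 (hstay s' hmem))⟩
      exact hsimple S' A' hEC
    have hupd : ∀ t ∈ D, Function.update rank s n t = rank t := fun t ht =>
      Function.update_of_ne (ne_of_mem_of_not_mem ht hs) _ _
    refine ⟨insert s D, Function.update rank s n, by rw [Finset.card_insert_of_notMem hs, hcard],
      fun t ht => ?_⟩
    rcases Finset.mem_insert.1 ht with rfl | ht
    · rw [Function.update_self]
      refine ⟨n.lt_succ_self, fun a ha => ?_⟩
      obtain ⟨s', hs', hpos⟩ := hexit a ha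
      exact ⟨s', Finset.mem_insert_of_mem hs', hpos, hupd s' hs' ▸ (hD s' hs').1⟩
    · rw [hupd t ht]
      refine ⟨(hD t ht).1.trans n.lt_succ_self, fun a ha => ?_⟩
      obtain ⟨s', hs', hpos, hlt⟩ := (hD t ht).2 a ha
      exact ⟨s', Finset.mem_insert_of_mem hs', hpos, (hupd s' hs').symm ▸ hlt⟩

/-- every simple MDP (i.e. without end-components) admits a
ranking function. -/
theorem simple_mdp_ranking (S A : Type) [Fintype S] [Fintype A] (M : MDP S A)
    (hsimple : ∀ S' A', ¬ M.IsEndComponent S' A') :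
    ∃ rank : S → ℕ, ∀ s : S,
      rank s < Fintype.card S ∧
      (rank s = 0 → ∀ a, ¬ M.enabled s a) ∧
      (∀ a, M.enabled s a → ∃ s', 0 < M.T s a s' ∧ rank s' < rank s) := by
  obtain ⟨D, rank, hcard, hD⟩ := M.exists_partial_ranking hsimple _ le_rfl
  obtain rfl := (Finset.card_eq_iff_eq_univ D).1 hcard
  refine ⟨rank, fun s => ⟨(hD s (Finset.mem_univ s)).1, fun h0 a ha => ?_, fun a ha => ?_⟩⟩
  · obtain ⟨s', -, -, hlt⟩ := (hD s (Finset.mem_univ s)).2 a ha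
    omega
  · obtain ⟨s', -, h⟩ := (hD s (Finset.mem_univ s)).2 a ha
    exact ⟨s', h⟩
end

section
/- Let M = (S, A, T, R) be a simple MDP, i.e. an MDP with no end-components, and define u : ℝ≥0^S → ℝ≥0^S by u(v)(s) = max_{a∈A(s)} Σ_{s'∈S} T(s,a,s')·v(s') (where the maximum over the empty set is 0). Then u is monotone, satisfies |u(v) − u(v')| ≤ u(|v − v'|) componentwise for all v, v' ∈ ℝ≥0^S, and there exists 0 ≤ c < 1 such that ‖u^{|S|}(v)‖ ≤ c·‖v‖ for all v ∈ ℝ≥0^S; moreover the state-value Bellman operator f_M satisfies |f_M(v) − f_M(v')| ≤ u(|v − v'|) componentwise for all v, v'. Hence f_M is witness-bounded with witness u. -/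
open Filter Set Topology

variable {S A : Type} [Fintype S] [Fintype A]

section SupInsertZero

variable {ι : Type*} [Finite ι] (p : ι → Prop) (g h k : ι → ℝ)

lemma finite_insert_zero_image :
    (insert 0 {x : ℝ | ∃ a, p a ∧ x = g a}).Finite := by
  refine (Set.Finite.subset (Set.finite_range g) ?_).insert 0
  rintro x ⟨a, -, rfl⟩
  exact ⟨a, rfl⟩

lemma sSup_insert_zero_le_iff (b : ℝ) :
    sSup (insert 0 {x : ℝ | ∃ a, p a ∧ x = g a}) ≤ b ↔ 0 ≤ b ∧ ∀ a, p a → g a ≤ b := by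
  rw [csSup_le_iff (finite_insert_zero_image p g).bddAbove (Set.insert_nonempty _ _)]
  simp only [Set.mem_insert_iff, Set.mem_ofPred_eq, forall_eq_or_imp]
  exact and_congr_right fun _ ↦ ⟨fun H a ha ↦ H _ ⟨a, ha, rfl⟩,
    by rintro H _ ⟨a, ha, rfl⟩; exact H a ha⟩

lemma sSup_insert_zero_lt_iff (b : ℝ) :
    sSup (insert 0 {x : ℝ | ∃ a, p a ∧ x = g a}) < b ↔ 0 < b ∧ ∀ a, p a → g a < b := by
  rw [(finite_insert_zero_image p g).csSup_lt_iff (Set.insert_nonempty _ _)]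
  simp only [Set.mem_insert_iff, Set.mem_ofPred_eq, forall_eq_or_imp]
  exact and_congr_right fun _ ↦ ⟨fun H a ha ↦ H _ ⟨a, ha, rfl⟩,
    by rintro H _ ⟨a, ha, rfl⟩; exact H a ha⟩

lemma abs_sSup_insert_zero_sub_le (H : ∀ a, p a → |g a - h a| ≤ k a) :
    |sSup (insert 0 {x : ℝ | ∃ a, p a ∧ x = g a}) -
        sSup (insert 0 {x : ℝ | ∃ a, p a ∧ x = h a})| ≤
      sSup (insert 0 {x : ℝ | ∃ a, p a ∧ x = k a}) := by
  have hg := (sSup_insert_zero_le_iff p g _).1 le_rfl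
  have hh := (sSup_insert_zero_le_iff p h _).1 le_rfl
  have hk := (sSup_insert_zero_le_iff p k _).1 le_rfl
  rw [abs_sub_le_iff, sub_le_iff_le_add, sub_le_iff_le_add, sSup_insert_zero_le_iff,
    sSup_insert_zero_le_iff]
  refine ⟨⟨add_nonneg hk.1 hh.1, fun a ha ↦ ?_⟩, ⟨add_nonneg hk.1 hg.1, fun a ha ↦ ?_⟩⟩
  · linarith [(abs_sub_le_iff.1 (H a ha)).1, hk.2 a ha, hh.2 a ha]
  · linarith [(abs_sub_le_iff.1 (H a ha)).2, hk.2 a ha, hg.2 a ha]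

end SupInsertZero

namespace MDP

/-- The Bellman operator of `M` with all rewards set to zero. -/
noncomputable def maxExpectation (M : MDP S A) (v : S → ℝ) : S → ℝ :=
  fun s => sSup (insert 0 {x : ℝ | ∃ a, M.enabled s a ∧ x = ∑ s', M.T s a s' * v s'})

variable (M : MDP S A)

lemma abs_sum_sub_sum_le (s : S) (a : A) (r v w : S → ℝ) :
    |∑ s', M.T s a s' * (r s' + v s') - ∑ s', M.T s a s' * (r s' + w s')| ≤
      ∑ s', M.T s a s' * |v s' - w s'| := by
  rw [← Finset.sum_sub_distrib]
  refine (Finset.abs_sum_le_sum_abs _ _).trans (Finset.sum_le_sum fun s' _ ↦ ?_)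
  rw [← mul_sub, add_sub_add_left_eq_sub, abs_mul, abs_of_nonneg (M.T_nonneg s a s')]

lemma abs_bellman_sub_le (v w : S → ℝ) (s : S) :
    |M.bellman v s - M.bellman w s| ≤ M.maxExpectation (fun t ↦ |v t - w t|) s :=
  abs_sSup_insert_zero_sub_le _ _ _ _ fun a _ ↦ M.abs_sum_sub_sum_le s a (M.R s a) v w

lemma abs_maxExpectation_sub_le (v w : S → ℝ) (s : S) :
    |M.maxExpectation v s - M.maxExpectation w s| ≤
      M.maxExpectation (fun t ↦ |v t - w t|) s :=
  abs_sSup_insert_zero_sub_le _ _ _ _ fun a _ ↦ by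
    simpa using M.abs_sum_sub_sum_le s a 0 v w

lemma maxExpectation_nonneg (v : S → ℝ) : 0 ≤ M.maxExpectation v :=
  fun _ ↦ ((sSup_insert_zero_le_iff _ _ _).1 le_rfl).1

lemma sum_le_maxExpectation (v : S → ℝ) {s : S} {a : A} (ha : M.enabled s a) :
    ∑ s', M.T s a s' * v s' ≤ M.maxExpectation v s :=
  ((sSup_insert_zero_le_iff _ (fun a ↦ ∑ s', M.T s a s' * v s') _).1 le_rfl).2 a ha

lemma maxExpectation_monotone : Monotone M.maxExpectation := by
  intro v w hvw s
  refine (sSup_insert_zero_le_iff _ _ _).2 ⟨M.maxExpectation_nonneg w s, fun a ha ↦ ?_⟩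
  refine le_trans (Finset.sum_le_sum fun s' _ ↦ ?_) (M.sum_le_maxExpectation w ha)
  exact mul_le_mul_of_nonneg_left (hvw s') (M.T_nonneg s a s')

lemma maxExpectation_one_le : M.maxExpectation 1 ≤ 1 := fun s ↦
  (sSup_insert_zero_le_iff _ _ _).2 ⟨zero_le_one, fun a ha ↦ by
    simpa using (show ∑ s', M.T s a s' = 1 from ha).le⟩

lemma maxExpectation_smul_le {c : ℝ} (hc : 0 ≤ c) (v : S → ℝ) :
    M.maxExpectation (c • v) ≤ c • M.maxExpectation v := fun s ↦ by
  refine (sSup_insert_zero_le_iff _ _ _).2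
    ⟨mul_nonneg hc (M.maxExpectation_nonneg v s), fun a ha ↦ ?_⟩
  calc ∑ s', M.T s a s' * (c • v) s' = c * ∑ s', M.T s a s' * v s' := by
        rw [Finset.mul_sum]
        exact Finset.sum_congr rfl fun s' _ ↦ by simp only [Pi.smul_apply, smul_eq_mul]; ring
    _ ≤ _ := mul_le_mul_of_nonneg_left (M.sum_le_maxExpectation v ha) hc

lemma iterate_maxExpectation_smul_le {c : ℝ} (hc : 0 ≤ c) (v : S → ℝ) (n : ℕ) :
    M.maxExpectation^[n] (c • v) ≤ c • M.maxExpectation^[n] v := by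
  induction n with
  | zero => rfl
  | succ n ih =>
    simp only [Function.iterate_succ_apply']
    exact (M.maxExpectation_monotone ih).trans (M.maxExpectation_smul_le hc _)

lemma iterate_maxExpectation_nonneg {v : S → ℝ} (hv : 0 ≤ v) (n : ℕ) :
    0 ≤ M.maxExpectation^[n] v := by
  cases n with
  | zero => exact hv
  | succ n => rw [Function.iterate_succ_apply']; exact M.maxExpectation_nonneg _

lemma iterate_maxExpectation_one_antitone : Antitone fun n ↦ M.maxExpectation^[n] 1 :=
  M.maxExpectation_monotone.antitone_iterate_of_map_le M.maxExpectation_one_le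

lemma iterate_maxExpectation_one_le (n : ℕ) : M.maxExpectation^[n] 1 ≤ 1 :=
  M.iterate_maxExpectation_one_antitone n.zero_le

lemma norm_iterate_maxExpectation_le {v : S → ℝ} (hv : 0 ≤ v) (n : ℕ) :
    ‖M.maxExpectation^[n] v‖ ≤ ‖M.maxExpectation^[n] 1‖ * ‖v‖ := by
  refine (pi_norm_le_iff_of_nonneg (by positivity)).2 fun s ↦ ?_
  rw [Real.norm_of_nonneg (M.iterate_maxExpectation_nonneg hv n s)]
  have hv1 : v ≤ ‖v‖ • (1 : S → ℝ) := fun t ↦ by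
    simpa using (le_abs_self _).trans (norm_le_pi_norm v t)
  calc M.maxExpectation^[n] v s ≤ M.maxExpectation^[n] (‖v‖ • (1 : S → ℝ)) s :=
        M.maxExpectation_monotone.iterate n hv1 s
    _ ≤ ‖v‖ * M.maxExpectation^[n] 1 s :=
        M.iterate_maxExpectation_smul_le (norm_nonneg v) 1 n s
    _ ≤ ‖v‖ * ‖M.maxExpectation^[n] 1‖ :=
        mul_le_mul_of_nonneg_left
          ((le_abs_self _).trans (norm_le_pi_norm (M.maxExpectation^[n] 1) s)) (norm_nonneg v)
    _ = _ := mul_comm _ _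

/-- The actions that are enabled in `s` and lead to `X` with certainty. -/
def safeActions (X : Set S) (s : S) : Set A :=
  {a | M.enabled s a ∧ ∀ s', 0 < M.T s a s' → s' ∈ X}

variable {M}

lemma maxExpectation_lt_one {v : S → ℝ} (hv : v ≤ 1) {s : S}
    (hs : M.safeActions {t | 1 ≤ v t} s = ∅) : M.maxExpectation v s < 1 := by
  refine (sSup_insert_zero_lt_iff _ _ _).2 ⟨zero_lt_one, fun a ha ↦ ?_⟩
  have hna : a ∉ M.safeActions {t | 1 ≤ v t} s := by simp [hs]
  simp only [safeActions, Set.mem_ofPred_eq, not_and, not_forall, not_le] at hna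
  obtain ⟨t, ht, hvt⟩ := hna ha
  calc ∑ s', M.T s a s' * v s' < ∑ s', M.T s a s' :=
        Finset.sum_lt_sum (fun s' _ ↦ mul_le_of_le_one_right (M.T_nonneg s a s') (hv s'))
          ⟨t, Finset.mem_univ t, mul_lt_of_lt_one_right ht hvt⟩
    _ = 1 := ha

lemma exists_isEndComponent {X : Set S} (hX : X.Nonempty)
    (hsafe : ∀ s ∈ X, (M.safeActions X s).Nonempty) : ∃ S' A', M.IsEndComponent S' A' := by
  obtain ⟨Y, ⟨hY, hYsafe⟩, hmin⟩ := (Set.toFinite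
    {X : Set S | X.Nonempty ∧ ∀ s ∈ X, (M.safeActions X s).Nonempty}).exists_minimal
      ⟨X, hX, hsafe⟩
  refine ⟨Y, fun s ↦ {a | s ∈ Y ∧ a ∈ M.safeActions Y s}, hY, fun s hs ↦ ?_, fun s hs ↦ ?_,
    fun s _ a ha ↦ ha.2.2, fun s hs ↦ ?_⟩
  · obtain ⟨a, ha⟩ := hYsafe s hs
    exact ⟨⟨a, hs, ha⟩, fun b hb ↦ hb.2.1⟩
  · simp [hs]
  · set step := M.ecStep Y fun s ↦ {a | s ∈ Y ∧ a ∈ M.safeActions Y s}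
    have hreach : {t | Relation.ReflTransGen step s t} ⊆ Y := by
      intro t ht
      induction ht with
      | refl => exact hs
      | tail _ h _ => obtain ⟨-, a, ha, hpos⟩ := h; exact ha.2.2 _ hpos
    refine hmin (y := {t | Relation.ReflTransGen step s t})
      ⟨⟨s, Relation.ReflTransGen.refl⟩, fun t ht ↦ ?_⟩ hreach
    obtain ⟨a, ha⟩ := hYsafe t (hreach ht)
    exact ⟨a, ha.1, fun t' hpos ↦ ht.tail ⟨hreach ht, a, ⟨hreach ht, ha⟩, hpos⟩⟩

lemma ncard_one_le_iterate_maxExpectation_le (hM : ∀ S' A', ¬ M.IsEndComponent S' A') (n : ℕ) :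
    {s | 1 ≤ M.maxExpectation^[n] 1 s}.ncard ≤ Fintype.card S - n := by
  induction n with
  | zero => simp
  | succ n ih =>
    set X := {s | 1 ≤ M.maxExpectation^[n] 1 s}
    have hsub : {s | 1 ≤ M.maxExpectation^[n + 1] 1 s} ⊆ X := fun s hs ↦
      le_trans hs (M.iterate_maxExpectation_one_antitone n.le_succ s)
    rcases X.eq_empty_or_nonempty with hX | hX
    · rw [hX, Set.subset_empty_iff] at hsub
      rw [hsub, Set.ncard_empty]
      exact Nat.zero_le _
    · obtain ⟨s, hs, hse⟩ : ∃ s ∈ X, M.safeActions X s = ∅ := by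
        by_contra! H
        obtain ⟨S', A', h⟩ := exists_isEndComponent hX H
        exact hM S' A' h
      have hlt : {s | 1 ≤ M.maxExpectation^[n + 1] 1 s}.ncard < X.ncard := by
        refine Set.ncard_lt_ncard ⟨hsub, fun h ↦
          not_lt_of_ge (show 1 ≤ M.maxExpectation^[n + 1] 1 s from h hs) ?_⟩
        rw [Function.iterate_succ_apply']
        exact maxExpectation_lt_one (M.iterate_maxExpectation_one_le n) hse
      omega

lemma norm_iterate_card_maxExpectation_one_lt (hM : ∀ S' A', ¬ M.IsEndComponent S' A') :
    ‖M.maxExpectation^[Fintype.card S] 1‖ < 1 := by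
  refine (pi_norm_lt_iff zero_lt_one).2 fun s ↦ ?_
  rw [Real.norm_of_nonneg (M.iterate_maxExpectation_nonneg zero_le_one _ s)]
  have h := ncard_one_le_iterate_maxExpectation_le hM (Fintype.card S)
  rw [Nat.sub_self, Nat.le_zero, Set.ncard_eq_zero] at h
  by_contra! hs
  exact (h ▸ hs : s ∈ (∅ : Set S))

end MDP

/-- the Bellman operator of a simple MDP is witness-bounded, with
witness `u(v)(s) = max_{a ∈ A(s)} Σ_{s'} T(s,a,s') v(s')`: `u` is monotone,
satisfies `|u v - u v'| ≤ u |v - v'|`, its `|S|`-th iterate shrinks norms by a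
factor `c < 1`, and `|f_M v - f_M v'| ≤ u |v - v'|`. -/
theorem simple_mdp_bellman_witness_bounded (S A : Type) [Fintype S] [Fintype A]
    (M : MDP S A)
    (hsimple : ∀ S' A', ¬ M.IsEndComponent S' A')
    (u : (S → ℝ) → (S → ℝ))
    (hu : ∀ v s, u v s = sSup (insert 0
      {x : ℝ | ∃ a, M.enabled s a ∧ x = ∑ s', M.T s a s' * v s'})) :
    (∀ v ∈ {v : S → ℝ | ∀ s, 0 ≤ v s}, ∀ w ∈ {v : S → ℝ | ∀ s, 0 ≤ v s},
      v ≤ w → u v ≤ u w) ∧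
    (∀ v ∈ {v : S → ℝ | ∀ s, 0 ≤ v s}, ∀ w ∈ {v : S → ℝ | ∀ s, 0 ≤ v s},
      ∀ s, |u v s - u w s| ≤ u (fun t => |v t - w t|) s) ∧
    (∃ c : ℝ, 0 ≤ c ∧ c < 1 ∧
      ∀ v ∈ {v : S → ℝ | ∀ s, 0 ≤ v s}, ‖u^[Fintype.card S] v‖ ≤ c * ‖v‖) ∧
    (∀ v ∈ {v : S → ℝ | ∀ s, 0 ≤ v s}, ∀ w ∈ {v : S → ℝ | ∀ s, 0 ≤ v s},
      ∀ s, |M.bellman v s - M.bellman w s| ≤ u (fun t => |v t - w t|) s) := by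
 
  obtain rfl : u = M.maxExpectation := funext fun v ↦ funext (hu v)
  exact ⟨fun v _ w _ h ↦ M.maxExpectation_monotone h,
    fun v _ w _ ↦ M.abs_maxExpectation_sub_le v w,
    ⟨_, norm_nonneg _, MDP.norm_iterate_card_maxExpectation_one_lt hsimple,
      fun v hv ↦ M.norm_iterate_maxExpectation_le hv _⟩,
    fun v _ w _ ↦ M.abs_bellman_sub_le v w⟩
end

section
/- An MDP M = (S, A, T, R) has finite value, i.e. its state-value Bellman operator f_M has a fixpoint in ℝ≥0^S, if and only if for every maximal end-component (S', A') of M and all s, s' ∈ S' and a ∈ A'(s) with T(s,a,s') > 0 it holds that R(s,a,s') = 0. -/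
open Filter Set Topology

variable {S A : Type} [Fintype S] [Fintype A]

namespace MDP

variable {M : MDP S A}

section Bellman

private lemma bellman_bddAbove (M : MDP S A) (v : S → ℝ) (s : S) :
    BddAbove (insert 0
      {x : ℝ | ∃ a, M.enabled s a ∧ x = ∑ s', M.T s a s' * (M.R s a s' + v s')}) := by
  refine (Set.Finite.insert 0 ?_).bddAbove
  refine (Set.finite_range fun a => ∑ s', M.T s a s' * (M.R s a s' + v s')).subset ?_
  rintro x ⟨a, -, rfl⟩
  exact ⟨a, rfl⟩

lemma bellman_nonneg (M : MDP S A) (v : S → ℝ) (s : S) : 0 ≤ M.bellman v s :=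
  le_csSup (bellman_bddAbove M v s) (Set.mem_insert _ _)

lemma le_bellman {s : S} {a : A} (h : M.enabled s a) (v : S → ℝ) :
    ∑ s', M.T s a s' * (M.R s a s' + v s') ≤ M.bellman v s :=
  le_csSup (bellman_bddAbove M v s) (Set.mem_insert_of_mem _ ⟨a, h, rfl⟩)

lemma bellman_le {v : S → ℝ} {s : S} {x : ℝ} (hx : 0 ≤ x)
    (h : ∀ a, M.enabled s a → ∑ s', M.T s a s' * (M.R s a s' + v s') ≤ x) :
    M.bellman v s ≤ x := by
  refine csSup_le (Set.insert_nonempty _ _) ?_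
  rintro y (rfl | ⟨a, ha, rfl⟩)
  exacts [hx, h a ha]

lemma bellman_mono (M : MDP S A) : Monotone M.bellman := fun _ v huv s =>
  bellman_le (bellman_nonneg M v s) fun _ ha =>
    (Finset.sum_le_sum fun s' _ => mul_le_mul_of_nonneg_left
      (add_le_add_right (huv s') _) (M.T_nonneg _ _ _)).trans (le_bellman ha v)

/-- A non-negative pre-fixpoint of the Bellman operator yields a non-negative fixpoint. -/
lemma exists_fixpoint_of_bellman_le {v : S → ℝ} (hv : 0 ≤ v) (h : M.bellman v ≤ v) :
    ∃ w : S → ℝ, (∀ s, 0 ≤ w s) ∧ M.bellman w = w := by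
  let P : Set (S → ℝ) := {u | 0 ≤ u ∧ M.bellman u ≤ u}
  have hP : P.Nonempty := ⟨v, hv, h⟩
  have hbdd : BddBelow P := ⟨0, fun u hu => hu.1⟩
  have h0 : 0 ≤ sInf P := le_csInf hP fun u hu => hu.1
  have hle : M.bellman (sInf P) ≤ sInf P :=
    le_csInf hP fun u hu => (M.bellman_mono (csInf_le hbdd hu)).trans hu.2
  refine ⟨sInf P, h0, le_antisymm hle (csInf_le hbdd ⟨?_, M.bellman_mono hle⟩)⟩
  exact fun s => bellman_nonneg M _ s

end Bellman

lemma IsEndComponent.exists_isMaximalEC {S' : Set S} {A' : S → Set A}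
    (h : M.IsEndComponent S' A') :
    ∃ S'' A'', M.IsMaximalEC S'' A'' ∧ S' ⊆ S'' ∧ ∀ s, A' s ⊆ A'' s := by
  obtain ⟨⟨S'', A''⟩, hle, hmax⟩ :=
    (Set.toFinite {p : Set S × (S → Set A) | M.IsEndComponent p.1 p.2}).exists_le_maximal
      (a := (S', A')) h
  refine ⟨S'', A'', ⟨hmax.prop, fun S₃ A₃ h₃ hS hA => ?_⟩, hle.1, hle.2⟩
  have := hmax.le_of_ge (y := (S₃, A₃)) h₃ ⟨hS, hA⟩
  exact ⟨this.1.antisymm hS, fun s => (this.2 s).antisymm (hA s)⟩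

lemma IsEndComponent.mem_of_mem {S' : Set S} {A' : S → Set A} (h : M.IsEndComponent S' A')
    {s : S} {a : A} (ha : a ∈ A' s) : s ∈ S' := by
  by_contra hs
  simp [h.2.2.1 s hs] at ha

/-- A function that is superharmonic along the actions of an end-component is constant on it. -/
lemma IsEndComponent.eq_of_superharmonic {S' : Set S} {A' : S → Set A}
    (h : M.IsEndComponent S' A') {v : S → ℝ}
    (hv : ∀ s ∈ S', ∀ a ∈ A' s, ∑ t, M.T s a t * v t ≤ v s) :
    ∃ c, ∀ s ∈ S', v s = c := by
  obtain ⟨hne, hen, -, hcl, hcon⟩ := h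
  obtain ⟨m, hm, hmin⟩ := (Set.toFinite S').exists_minimalFor v S' hne
  have hmin' : ∀ t ∈ S', v m ≤ v t := fun t ht =>
    (le_total (v m) (v t)).elim id fun h => hmin ht h
  refine ⟨v m, fun s hs => ?_⟩
  suffices s ∈ S' ∧ v s = v m from this.2
  have hpath := hcon m hm s hs
  clear hs
  induction hpath with
  | refl => exact ⟨hm, rfl⟩
  | @tail t u _ htu ih =>
    obtain ⟨ht, a, ha, hpos⟩ := htu
    have hu := hcl t ht a ha u hpos
    refine ⟨hu, le_antisymm ?_ (hmin' u hu)⟩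
    by_contra! hlt
    have hsum : ∑ t', M.T t a t' * v m < ∑ t', M.T t a t' * v t' := by
      refine Finset.sum_lt_sum (fun t' _ => ?_) ⟨u, Finset.mem_univ _, by gcongr⟩
      rcases (M.T_nonneg t a t').eq_or_lt with h0 | h0
      · simp [← h0]
      · have := hmin' t' (hcl t ht a ha t' h0)
        gcongr
    rw [← Finset.sum_mul, show ∑ t', M.T t a t' = 1 from (hen t ht).2 a ha] at hsum
    linarith [hv t ht a ha, ih.2]

/-- The state-action pair `(s, a)` lies in some end-component. -/
def InEC (M : MDP S A) (s : S) (a : A) : Prop :=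
  ∃ S' A', M.IsEndComponent S' A' ∧ a ∈ A' s

lemma InEC.enabled {s : S} {a : A} (h : M.InEC s a) : M.enabled s a := by
  obtain ⟨S', A', h, ha⟩ := h
  exact (h.2.1 s (h.mem_of_mem ha)).2 a ha

/-- Reachability using only actions of end-components. -/
def ECReach (M : MDP S A) : S → S → Prop :=
  Relation.ReflTransGen fun s t => ∃ a, M.InEC s a ∧ 0 < M.T s a t

lemma ECReach.symm {s t : S} (h : M.ECReach s t) : M.ECReach t s := by
  induction h with
  | refl => exact .refl
  | tail _ hstep ih =>
    refine .trans ?_ ih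
    obtain ⟨a, ⟨S', A', h, ha⟩, hpos⟩ := hstep
    have hs := h.mem_of_mem ha
    refine Relation.ReflTransGen.mono ?_ _ _ (h.2.2.2.2 _ (h.2.2.2.1 _ hs a ha _ hpos) _ hs)
    rintro x y ⟨-, b, hb, hxy⟩
    exact ⟨b, ⟨S', A', h, hb⟩, hxy⟩

lemma ECReach.of_inEC {s t : S} {a : A} (h : M.InEC s a) (ht : 0 < M.T s a t) :
    M.ECReach s t := .single ⟨a, h, ht⟩

/-- In a finite type, every point reaches one from which all reachable points lead back. -/
lemma _root_.Relation.exists_reflTransGen_recurrent {α : Type*} [Finite α] (r : α → α → Prop)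
    (x : α) : ∃ y, Relation.ReflTransGen r x y ∧
      ∀ z, Relation.ReflTransGen r y z → Relation.ReflTransGen r z y := by
  obtain ⟨y, hxy, hmin⟩ := (Set.toFinite {y | Relation.ReflTransGen r x y}).exists_minimalFor
    (fun y => {z | Relation.ReflTransGen r y z}) _ ⟨x, .refl⟩
  refine ⟨y, hxy, fun z hyz => ?_⟩
  exact hmin (hxy.trans hyz) (fun _ hw => hyz.trans hw) (Relation.ReflTransGen.refl (a := y))

/-- A nonempty set of states closed under `ECReach` contains a class all of whose actions outside
end-components may leave the set. -/
lemma exists_forall_exists_notMem {Q : Set S} (hQ : Q.Nonempty)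
    (hinv : ∀ s t, M.ECReach s t → s ∈ Q → t ∈ Q) :
    ∃ s ∈ Q, ∀ t, M.ECReach s t → ∀ a, M.enabled t a → ¬ M.InEC t a →
      ∃ u, 0 < M.T t a u ∧ u ∉ Q := by
  by_contra! hcon
  let act : S → Set A := fun s => {a | M.enabled s a ∧ ∀ u, 0 < M.T s a u → u ∈ Q}
  let r : S → S → Prop := fun s t => ∃ a ∈ act s, 0 < M.T s a t
  have hact : ∀ s ∈ Q, ∀ a, M.InEC s a → a ∈ act s := fun s hs a ha =>
    ⟨ha.enabled, fun u hu => hinv s u (.of_inEC ha hu) hs⟩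
  have hreach : ∀ s t, M.ECReach s t → s ∈ Q → Relation.ReflTransGen r s t := by
    intro s t h hs
    induction h with
    | refl => exact .refl
    | tail h hstep ih =>
      obtain ⟨a, ha, hpos⟩ := hstep
      exact ih.tail ⟨a, hact _ (hinv _ _ h hs) a ha, hpos⟩
  have hrQ : ∀ s t, Relation.ReflTransGen r s t → s ∈ Q → t ∈ Q := by
    intro s t h hs
    induction h with
    | refl => exact hs
    | tail _ hstep _ =>
      obtain ⟨a, ha, hpos⟩ := hstep
      exact ha.2 _ hpos
  obtain ⟨q, hq⟩ := hQ
  obtain ⟨y, hqy, hrec⟩ := Relation.exists_reflTransGen_recurrent r q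
  have hyQ := hrQ q y hqy hq
  let B : Set S := {t | Relation.ReflTransGen r y t}
  have hBQ : ∀ t ∈ B, t ∈ Q := fun t ht => hrQ y t ht hyQ
  have hEC : M.IsEndComponent B (fun s => {a | s ∈ B ∧ a ∈ act s}) := by
    refine ⟨⟨y, .refl⟩, fun s hs => ⟨?_, fun a ha => ha.2.1⟩, fun s hs => ?_,
      fun s hs a ha t ht => Relation.ReflTransGen.tail hs ⟨a, ha.2, ht⟩, fun s hs t ht => ?_⟩
    · obtain ⟨t, hst, a, ha, -, haQ⟩ := hcon s (hBQ s hs)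
      rcases Relation.ReflTransGen.cases_head hst with rfl | ⟨u, ⟨b, hb, -⟩, -⟩
      · exact ⟨a, hs, ha, haQ⟩
      · exact ⟨b, hs, hact s (hBQ s hs) b hb⟩
    · ext a
      simp [hs]
    · have hst : Relation.ReflTransGen r s t := (hrec s hs).trans ht
      clear ht
      induction hst with
      | refl => exact .refl
      | tail h hstep ih =>
        obtain ⟨a, ha, hpos⟩ := hstep
        have hB : _ ∈ B := Relation.ReflTransGen.trans hs h
        exact ih.tail ⟨hB, a, ⟨hB, ha⟩, hpos⟩
  obtain ⟨t, hyt, a, ha, hna, haQ⟩ := hcon y hyQ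
  exact hna ⟨_, _, hEC, hreach y t hyt hyQ, ha, haQ⟩

/-- There is a non-negative function, constant along end-components, that decreases strictly in
expectation under every action outside the end-components. -/
lemma exists_potential (M : MDP S A) :
    ∃ w : S → ℝ, (∀ s, 0 ≤ w s) ∧ (∀ s t, M.ECReach s t → w s = w t) ∧
      ∀ s a, M.enabled s a → ¬ M.InEC s a → ∑ t, M.T s a t * w t < w s := by
  classical
  let P : Set (S → ℝ) := {w | (∀ s, 0 ≤ w s) ∧ (∀ s, w s ≤ 1) ∧
    (∀ s t, M.ECReach s t → w s = w t) ∧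
    ∀ s a, w s < 1 → M.enabled s a → ¬ M.InEC s a → ∑ t, M.T s a t * w t < w s}
  have hP : (fun _ => 1 : S → ℝ) ∈ P := by simp [P]
  let N : Set (Set S) := (fun w : S → ℝ => {s | w s < 1}) '' P
  obtain ⟨_, ⟨w, ⟨hw0, hw1, hwr, hwd⟩, rfl⟩, hmax⟩ :=
    (Set.toFinite N).exists_maximal ⟨_, _, hP, rfl⟩
  suffices hlt : ∀ s, w s < 1 from ⟨w, hw0, hwr, fun s a => hwd s a (hlt s)⟩
  by_contra! hcon
  obtain ⟨q, hq⟩ := hcon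
  obtain ⟨s₀, hs₀, hesc⟩ := exists_forall_exists_notMem (M := M) (Q := {s | 1 ≤ w s}) ⟨q, hq⟩
    fun s t hst hs => by simpa [← hwr s t hst] using hs
  have hval : ∀ t a, M.ECReach s₀ t → M.enabled t a → ¬ M.InEC t a →
      ∑ u, M.T t a u * w u < 1 := by
    intro t a ht ha hna
    obtain ⟨u, hu, huQ⟩ := hesc t ht a ha hna
    rw [← show ∑ u, M.T t a u = 1 from ha]
    refine Finset.sum_lt_sum (fun x _ => mul_le_of_le_one_right (M.T_nonneg _ _ _) (hw1 x))
      ⟨u, Finset.mem_univ _, mul_lt_of_lt_one_right hu (not_le.1 huQ)⟩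
  obtain ⟨c, hc, hc0, hc1⟩ : ∃ c : ℝ, (∀ p : S × A, M.ECReach s₀ p.1 → M.enabled p.1 p.2 →
      ¬ M.InEC p.1 p.2 → ∑ u, M.T p.1 p.2 u * w u < c) ∧ 0 < c ∧ c < 1 := by
    have h1 : ∀ᶠ c : ℝ in 𝓝[<] 1, ∀ p : S × A, M.ECReach s₀ p.1 → M.enabled p.1 p.2 →
        ¬ M.InEC p.1 p.2 → ∑ u, M.T p.1 p.2 u * w u < c := by
      refine Filter.eventually_all.2 fun p => ?_
      by_cases h : M.ECReach s₀ p.1 ∧ M.enabled p.1 p.2 ∧ ¬ M.InEC p.1 p.2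
      · filter_upwards [nhdsWithin_le_nhds (lt_mem_nhds (hval p.1 p.2 h.1 h.2.1 h.2.2))]
          with c hc _ _ _ using hc
      · exact .of_forall fun c h1 h2 h3 => absurd ⟨h1, h2, h3⟩ h
    have h0 : ∀ᶠ c : ℝ in 𝓝[<] 1, 0 < c := nhdsWithin_le_nhds (lt_mem_nhds one_pos)
    exact (h1.and (h0.and self_mem_nhdsWithin)).exists
  let w' : S → ℝ := fun s => if M.ECReach s₀ s then c else w s
  have hclass : ∀ s, M.ECReach s₀ s → 1 ≤ w s := fun s hs => (hwr s₀ s hs) ▸ hs₀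
  have hw'w : ∀ s, w' s ≤ w s := by
    intro s
    by_cases h : M.ECReach s₀ s
    · simpa [w', h] using hc1.le.trans (hclass s h)
    · simp [w', h]
  have hsum : ∀ s a, ∑ t, M.T s a t * w' t ≤ ∑ t, M.T s a t * w t := fun s a =>
    Finset.sum_le_sum fun t _ => mul_le_mul_of_nonneg_left (hw'w t) (M.T_nonneg _ _ _)
  have hw' : w' ∈ P := by
    refine ⟨fun s => ?_, fun s => (hw'w s).trans (hw1 s), fun s t hst => ?_,
      fun s a hs ha hna => (hsum s a).trans_lt ?_⟩
    · by_cases h : M.ECReach s₀ s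
      · simpa [w', h] using hc0.le
      · simpa [w', h] using hw0 s
    · have : M.ECReach s₀ s ↔ M.ECReach s₀ t :=
        ⟨fun h => Relation.ReflTransGen.trans h hst,
          fun h => Relation.ReflTransGen.trans h hst.symm⟩
      simp [w', this, hwr s t hst]
    · by_cases h : M.ECReach s₀ s
      · simpa [w', h] using hc (s, a) h ha hna
      · simp only [w', h, if_false] at hs ⊢
        exact hwd s a hs ha hna
  have hle : {s | w s < 1} ⊆ {s | w' s < 1} := fun s hs => (hw'w s).trans_lt hs
  have hmem : s₀ ∈ {s | w' s < 1} := by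
    simpa [w', show M.ECReach s₀ s₀ from .refl] using hc1
  have hlt : w s₀ < 1 := hmax ⟨w', hw', rfl⟩ hle hmem
  exact not_lt.2 hs₀ hlt

/-- If the rewards in end-components vanish, the Bellman operator has a non-negative
pre-fixpoint. -/
lemma exists_bellman_le
    (h : ∀ s a, M.InEC s a → ∀ t, 0 < M.T s a t → M.R s a t = 0) :
    ∃ v : S → ℝ, 0 ≤ v ∧ M.bellman v ≤ v := by
  obtain ⟨w, hw0, hwr, hwd⟩ := M.exists_potential
  obtain ⟨C, hC, hC0⟩ : ∃ C : ℝ, (∀ p : S × A, M.enabled p.1 p.2 → ¬ M.InEC p.1 p.2 →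
      ∑ t, M.T p.1 p.2 t * M.R p.1 p.2 t ≤
        C * (w p.1 - ∑ t, M.T p.1 p.2 t * w t)) ∧ 0 ≤ C := by
    refine ((Filter.eventually_all.2 fun p => ?_).and (Filter.eventually_ge_atTop 0)).exists
      (f := Filter.atTop)
    by_cases hp : M.enabled p.1 p.2 ∧ ¬ M.InEC p.1 p.2
    · filter_upwards [(Filter.tendsto_id.atTop_mul_const
        (sub_pos.2 (hwd p.1 p.2 hp.1 hp.2))).eventually_ge_atTop _] with C hC _ _ using hC
    · exact .of_forall fun C h1 h2 => absurd ⟨h1, h2⟩ hp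
  refine ⟨fun s => C * w s, fun s => mul_nonneg hC0 (hw0 s), fun s =>
    bellman_le (mul_nonneg hC0 (hw0 s)) fun a ha => ?_⟩
  have hsplit : ∑ t, M.T s a t * (M.R s a t + C * w t) =
      ∑ t, M.T s a t * M.R s a t + C * ∑ t, M.T s a t * w t := by
    rw [Finset.mul_sum, ← Finset.sum_add_distrib]
    exact Finset.sum_congr rfl fun t _ => by ring
  by_cases hEC : M.InEC s a
  · refine le_of_eq ?_
    calc ∑ t, M.T s a t * (M.R s a t + C * w t) = ∑ t, M.T s a t * (C * w s) := by
          refine Finset.sum_congr rfl fun t _ => ?_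
          rcases (M.T_nonneg s a t).eq_or_lt with h0 | h0
          · simp [← h0]
          · rw [h s a hEC t h0, hwr s t (.of_inEC hEC h0), zero_add]
      _ = C * w s := by rw [← Finset.sum_mul, show ∑ t, M.T s a t = 1 from ha, one_mul]
  · rw [hsplit]
    linarith [hC (s, a) ha hEC]

/-- Rewards inside end-components vanish if the Bellman operator has a fixpoint. -/
lemma IsEndComponent.reward_eq_zero {S' : Set S} {A' : S → Set A} (h : M.IsEndComponent S' A')
    {v : S → ℝ} (hv : M.bellman v = v) {s t : S} {a : A} (ha : a ∈ A' s)
    (ht : 0 < M.T s a t) : M.R s a t = 0 := by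
  have hstep : ∀ s ∈ S', ∀ a ∈ A' s,
      ∑ t, M.T s a t * M.R s a t + ∑ t, M.T s a t * v t ≤ v s := by
    intro s hs a ha
    have := le_bellman ((h.2.1 s hs).2 a ha) v
    rwa [hv, Finset.sum_congr rfl fun t _ => mul_add _ _ _, Finset.sum_add_distrib] at this
  have hnn : ∀ s a t, 0 ≤ M.T s a t * M.R s a t := fun s a t =>
    mul_nonneg (M.T_nonneg _ _ _) (M.R_nonneg _ _ _)
  obtain ⟨c, hc⟩ := h.eq_of_superharmonic (v := v) fun s hs a ha =>
    (le_add_of_nonneg_left (Finset.sum_nonneg fun t _ => hnn s a t)).trans (hstep s hs a ha)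
  have hs := h.mem_of_mem ha
  have hconst : ∑ t, M.T s a t * v t = c := by
    calc ∑ t, M.T s a t * v t = ∑ t, M.T s a t * c := by
          refine Finset.sum_congr rfl fun t _ => ?_
          rcases (M.T_nonneg s a t).eq_or_lt with h0 | h0
          · simp [← h0]
          · rw [hc t (h.2.2.2.1 s hs a ha t h0)]
      _ = c := by
          rw [← Finset.sum_mul, show ∑ t, M.T s a t = 1 from (h.2.1 s hs).2 a ha, one_mul]
  have hle := hstep s hs a ha
  rw [hconst, hc s hs] at hle
  have hsingle := Finset.single_le_sum (fun t _ => hnn s a t) (Finset.mem_univ t)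
  have h0 : M.T s a t * M.R s a t = 0 := le_antisymm (by linarith) (hnn s a t)
  exact (mul_eq_zero.1 h0).resolve_left ht.ne'

end MDP

/-- an MDP has finite value (its Bellman operator has a fixpoint
in the non-negative orthant) if and only if all rewards of positive-probability
transitions inside maximal end-components vanish. -/
theorem finite_value_iff_zero_reward_in_MECs (S A : Type) [Fintype S] [Fintype A]
    (M : MDP S A) :
    (∃ v : S → ℝ, (∀ s, 0 ≤ v s) ∧ M.bellman v = v) ↔
    (∀ S' A', M.IsMaximalEC S' A' →
      ∀ s ∈ S', ∀ s' ∈ S', ∀ a ∈ A' s, 0 < M.T s a s' → M.R s a s' = 0) := by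
  constructor
  · rintro ⟨v, -, hv⟩ S' A' hmax s _ s' _ a ha ht
    exact hmax.1.reward_eq_zero hv ha ht
  · intro h
    obtain ⟨v, hv0, hv⟩ := MDP.exists_bellman_le (M := M) fun s a ⟨S', A', hEC, ha⟩ t ht => by
      obtain ⟨S'', A'', hmax, -, hA⟩ := hEC.exists_isMaximalEC
      have hs := hmax.1.mem_of_mem (hA s ha)
      exact h S'' A'' hmax s hs t (hmax.1.2.2.2.1 s hs a (hA s ha) t ht) a (hA s ha) ht
    exact MDP.exists_fixpoint_of_bellman_le hv0 hv
end
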